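/- Let g and v be positive integers, let q be a prime, and let n be a positive integer with n ≤ (q² + q + 1)·v. Then η_g(n) ≤ (q + 1)·η_g(v). -/

import Mathlib

/-- `A` is a `g`-difference basis for `[n]`: for every integer `x` with `1 ≤ x ≤ n`
there are at least `g` ordered pairs `(a₁, a₂) ∈ A × A` with `a₁ - a₂ = x`. -/
def IsGDiffBasis (g n : ℕ) (A : Finset ℤ) : Prop :=
  ∀ x : ℤ, 1 ≤ x → x ≤ (n : ℤ) →
    g ≤ ((A ×ˢ A).filter (fun p => p.1 - p.2 = x)).card

/-- `eta g n` is the smallest cardinality of a `g`-difference basis for `[n]`. -/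
noncomputable def eta (g n : ℕ) : ℕ :=
  sInf {k | ∃ A : Finset ℤ, A.card = k ∧ IsGDiffBasis g n A}

theorem pow_three_sub_one_eq {q : ℕ} (hq : 1 < q) :
    q ^ 3 - 1 = (q - 1) * (q ^ 2 + q + 1) := by
  obtain ⟨k, rfl⟩ := Nat.exists_eq_add_of_lt hq
  zify [Nat.one_le_pow 3 (1 + k + 1) (by omega), (by omega : 1 ≤ 1 + k + 1)]
  ring

section Singer

variable {F K : Type*} [Field F] [Field K] [Algebra F K]

/-- The exponents `i < q² + q + 1` for which `θ ^ i` has trace zero, where `q = #F`. -/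
noncomputable def singerSet (F : Type*) {K : Type*} [Field F] [Field K] [Algebra F K] (θ : Kˣ) :
    Finset ℕ :=
  open Classical in
  (Finset.range (Nat.card F ^ 2 + Nat.card F + 1)).filter
    fun i => Algebra.trace F K ((θ : K) ^ i) = 0

theorem mem_singerSet {θ : Kˣ} {i : ℕ} :
    i ∈ singerSet F θ ↔
      i < Nat.card F ^ 2 + Nat.card F + 1 ∧ Algebra.trace F K ((θ : K) ^ i) = 0 := by
  simp [singerSet]

variable [Finite K]

theorem natCard_units_of_finrank_eq_three [Finite F] (h : Module.finrank F K = 3) :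
    Nat.card Kˣ = (Nat.card F - 1) * (Nat.card F ^ 2 + Nat.card F + 1) := by
  rw [Nat.card_units, Module.natCard_eq_pow_finrank (K := F) (V := K), h,
    pow_three_sub_one_eq Finite.one_lt_card]

theorem algebraMap_norm_eq_pow_of_finrank_eq_three [Finite F] (h : Module.finrank F K = 3)
    (x : K) :
    algebraMap F K (Algebra.norm F x) = x ^ (Nat.card F ^ 2 + Nat.card F + 1) := by
  have hq : 1 < Nat.card F := Finite.one_lt_card
  rw [FiniteField.algebraMap_norm_eq_pow, Module.natCard_eq_pow_finrank (K := F) (V := K), h,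
    pow_three_sub_one_eq hq, Nat.mul_div_cancel_left _ (by omega)]

theorem trace_pow_mod_eq_zero [Finite F] (h : Module.finrank F K = 3) (θ : Kˣ) {i : ℕ}
    (hi : Algebra.trace F K ((θ : K) ^ i) = 0) :
    Algebra.trace F K ((θ : K) ^ (i % (Nat.card F ^ 2 + Nat.card F + 1))) = 0 := by
  rw [← Nat.mod_add_div i (Nat.card F ^ 2 + Nat.card F + 1), pow_add, pow_mul,
    ← algebraMap_norm_eq_pow_of_finrank_eq_three h, ← map_pow, mul_comm, ← Algebra.smul_def,
    map_smul, smul_eq_zero] at hi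
  refine hi.resolve_left (pow_ne_zero _ ?_)
  rw [Algebra.norm_ne_zero_iff]
  exact θ.ne_zero

theorem natCard_ker_trace [Finite F] (h : Module.finrank F K = 3) :
    Nat.card (LinearMap.ker (Algebra.trace F K)) = Nat.card F ^ 2 := by
  have h1 := LinearMap.finrank_range_add_finrank_ker (Algebra.trace F K)
  rw [LinearMap.range_eq_top.2 (Algebra.trace_surjective F K), finrank_top, Module.finrank_self,
    h] at h1
  rw [Module.natCard_eq_pow_finrank (K := F)]
  congr 1
  omega

theorem exists_ne_zero_trace_eq_zero [Finite F] (h : Module.finrank F K = 3) (y : K) :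
    ∃ w : K, w ≠ 0 ∧ Algebra.trace F K w = 0 ∧ Algebra.trace F K (y * w) = 0 := by
  let f : K →ₗ[F] F × F :=
    (Algebra.trace F K).prod ((Algebra.trace F K).comp (LinearMap.mulLeft F y))
  have hf : LinearMap.ker f ≠ ⊥ := LinearMap.ker_ne_bot_of_finrank_lt (by simp [h])
  obtain ⟨w, hw, hw0⟩ := Submodule.exists_mem_ne_zero_of_ne_bot hf
  have hw' : Algebra.trace F K w = 0 ∧ Algebra.trace F K (y * w) = 0 := by
    simpa [f, LinearMap.mem_ker] using hw
  exact ⟨w, hw0, hw'⟩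

theorem card_singerSet_le [Finite F] (h : Module.finrank F K = 3) {θ : Kˣ}
    (hθ : ∀ u, u ∈ Subgroup.zpowers θ) : (singerSet F θ).card ≤ Nat.card F + 1 := by
  have hq : 1 < Nat.card F := Finite.one_lt_card
  have hord := orderOf_eq_card_of_forall_mem_zpowers hθ
  rw [natCard_units_of_finrank_eq_three h] at hord
  let f : singerSet F θ × Fˣ → {w : LinearMap.ker (Algebra.trace F K) // w ≠ 0} := fun p =>
    ⟨⟨(p.2 : F) • (θ : K) ^ (p.1 : ℕ), by
      rw [LinearMap.mem_ker, map_smul, (mem_singerSet.1 p.1.2).2, smul_zero]⟩, by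
      simp [Subtype.ext_iff]⟩
  have hf : Function.Injective f := by
    rintro ⟨⟨i, hi⟩, c⟩ ⟨⟨j, hj⟩, d⟩ hij
    have hij' : (c : F) • (θ : K) ^ i = (d : F) • (θ : K) ^ j :=
      congrArg (fun w => ((w.1 : LinearMap.ker (Algebra.trace F K)) : K)) hij
    have hpow : θ ^ (i * (Nat.card F - 1)) = θ ^ (j * (Nat.card F - 1)) := by
      have hu (u : Fˣ) : (algebraMap F K u) ^ (Nat.card F - 1) = 1 := by
        rw [← map_pow, ← Units.val_pow_eq_pow_val, ← Nat.card_units, pow_card_eq_one']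
        simp
      have := congrArg (· ^ (Nat.card F - 1)) hij'
      simp only [Algebra.smul_def, mul_pow, hu, one_mul, ← pow_mul] at this
      exact Units.ext (by simpa using this)
    rw [pow_inj_mod, hord, mul_comm i, mul_comm j, Nat.mul_mod_mul_left, Nat.mul_mod_mul_left,
      Nat.mod_eq_of_lt (mem_singerSet.1 hi).1, Nat.mod_eq_of_lt (mem_singerSet.1 hj).1] at hpow
    obtain rfl : i = j := Nat.eq_of_mul_eq_mul_left (by omega) hpow
    have hcd : (c : F) = d := smul_left_injective F (pow_ne_zero i θ.ne_zero) hij'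
    rw [Units.ext hcd]
  have hcard := Nat.card_le_card_of_injective f hf
  classical
  have hne : Nat.card {w : LinearMap.ker (Algebra.trace F K) // w ≠ 0} = Nat.card F ^ 2 - 1 := by
    rw [← natCard_ker_trace (K := K) h]
    have := Nat.card_congr (Equiv.optionSubtypeNe (0 : LinearMap.ker (Algebra.trace F K)))
    rw [Finite.card_option] at this
    omega
  rw [hne, Nat.card_prod, Nat.card_units, Nat.card_eq_finsetCard] at hcard
  refine Nat.le_of_mul_le_mul_right (hcard.trans_eq ?_) (Nat.sub_pos_of_lt hq)
  simpa using Nat.sq_sub_sq (Nat.card F) 1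

theorem exists_mem_singerSet_modEq_sub [Finite F] (h : Module.finrank F K = 3) {θ : Kˣ}
    (hθ : ∀ u, u ∈ Subgroup.zpowers θ) (x : ℤ) :
    ∃ i ∈ singerSet F θ, ∃ j ∈ singerSet F θ,
      ((Nat.card F ^ 2 + Nat.card F + 1 : ℕ) : ℤ) ∣ x - (i - j) := by
  obtain ⟨w, hw0, hw, hw'⟩ := exists_ne_zero_trace_eq_zero (F := F) h ((θ ^ x : Kˣ) : K)
  have hfin : IsOfFinOrder θ := isOfFinOrder_of_finite θ
  obtain ⟨j, hj⟩ := hfin.mem_powers_iff_mem_zpowers.2 (hθ (Units.mk0 w hw0))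
  obtain ⟨i, hi⟩ := hfin.mem_powers_iff_mem_zpowers.2 (hθ (θ ^ x * Units.mk0 w hw0))
  simp only at hi hj
  have hord := orderOf_eq_card_of_forall_mem_zpowers hθ
  rw [natCard_units_of_finrank_eq_three h] at hord
  have hdvd : (orderOf θ : ℤ) ∣ x - (i - j) := by
    rw [orderOf_dvd_iff_zpow_eq_one, zpow_sub, zpow_sub, zpow_natCast, zpow_natCast, hi, hj]
    simp
  rw [hord, Nat.cast_mul] at hdvd
  have hjw : (θ : K) ^ j = w := by simpa using congrArg Units.val hj
  have hiw : (θ : K) ^ i = ((θ ^ x : Kˣ) : K) * w := by simpa using congrArg Units.val hi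
  have hN : 0 < Nat.card F ^ 2 + Nat.card F + 1 := Nat.succ_pos _
  refine ⟨_, mem_singerSet.2 ⟨Nat.mod_lt i hN, trace_pow_mod_eq_zero h θ (by rw [hiw, hw'])⟩,
    _, mem_singerSet.2 ⟨Nat.mod_lt j hN, trace_pow_mod_eq_zero h θ (by rw [hjw, hw])⟩, ?_⟩
  have hi' := Int.dvd_self_sub_emod (x := i) (m := ((Nat.card F ^ 2 + Nat.card F + 1 : ℕ) : ℤ))
  have hj' := Int.dvd_self_sub_emod (x := j) (m := ((Nat.card F ^ 2 + Nat.card F + 1 : ℕ) : ℤ))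
  have := ((dvd_of_mul_left_dvd hdvd).add hi').sub hj'
  rw [Int.natCast_mod, Int.natCast_mod]
  refine this.trans (dvd_of_eq ?_)
  ring

end Singer

/-- **Singer's theorem** (covering form): for a prime `q` there are `q + 1` residues modulo
`q² + q + 1` whose differences represent every residue class. -/
theorem exists_singer_difference_set {q : ℕ} (hq : q.Prime) :
    ∃ D : Finset ℕ, D.card ≤ q + 1 ∧ (∀ i ∈ D, i < q ^ 2 + q + 1) ∧
      ∀ x : ℤ, ∃ i ∈ D, ∃ j ∈ D, ((q ^ 2 + q + 1 : ℕ) : ℤ) ∣ x - (i - j) := by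
  have : Fact q.Prime := ⟨hq⟩
  have h : Module.finrank (ZMod q) (GaloisField q 3) = 3 := GaloisField.finrank q (by norm_num)
  obtain ⟨θ, hθ⟩ := IsCyclic.exists_generator (α := (GaloisField q 3)ˣ)
  have hcard := card_singerSet_le h hθ
  have hlt (i : ℕ) (hi : i ∈ singerSet (ZMod q) θ) := (mem_singerSet.1 hi).1
  have hcover := exists_mem_singerSet_modEq_sub h hθ
  rw [Nat.card_zmod] at hcard hcover
  simp only [Nat.card_zmod] at hlt
  exact ⟨_, hcard, hlt, hcover⟩

theorem exists_isGDiffBasis (g n : ℕ) : ∃ A : Finset ℤ, IsGDiffBasis g n A := by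
  refine ⟨Finset.Icc 0 (n + g), fun x hx1 hxn => ?_⟩
  have hcard : ((Finset.range g).image fun i : ℕ => (x + i, (i : ℤ))).card = g := by
    rw [Finset.card_image_of_injective, Finset.card_range]
    intro i j hij
    simpa using hij
  refine hcard.ge.trans (Finset.card_le_card fun p hp => ?_)
  obtain ⟨i, hi, rfl⟩ := Finset.mem_image.1 hp
  have := Finset.mem_range.1 hi
  simp only [Finset.mem_filter, Finset.mem_product, Finset.mem_Icc]
  omega

theorem exists_card_eq_eta (g n : ℕ) : ∃ A : Finset ℤ, A.card = eta g n ∧ IsGDiffBasis g n A := by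
  obtain ⟨A, hA⟩ := exists_isGDiffBasis g n
  exact Nat.sInf_mem (s := {k | ∃ A : Finset ℤ, A.card = k ∧ IsGDiffBasis g n A}) ⟨_, A, rfl, hA⟩

theorem IsGDiffBasis.eta_le_card {g n : ℕ} {A : Finset ℤ} (hA : IsGDiffBasis g n A) :
    eta g n ≤ A.card :=
  Nat.sInf_le ⟨A, rfl, hA⟩

theorem IsGDiffBasis.le_card {g n : ℕ} {A : Finset ℤ} (hA : IsGDiffBasis g n A) (hn : 0 < n) :
    g ≤ A.card := by
  refine (hA 1 le_rfl (by omega)).trans (Finset.card_le_card_of_injOn Prod.fst ?_ ?_)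
  · intro p hp
    simp only [Finset.coe_filter, Finset.mem_product, Set.mem_ofPred_eq] at hp
    exact hp.1.1
  · intro p hp p' hp' h
    simp only [Finset.coe_filter, Set.mem_ofPred_eq] at hp hp'
    exact Prod.ext h (by omega)

theorem IsGDiffBasis.le_card_filter {g n : ℕ} {A : Finset ℤ} (hA : IsGDiffBasis g n A)
    (hn : 0 < n) {x : ℤ} (hx0 : 0 ≤ x) (hxn : x ≤ n) :
    g ≤ ((A ×ˢ A).filter (fun p => p.1 - p.2 = x)).card := by
  rcases hx0.eq_or_lt with rfl | hx0
  · refine (hA.le_card hn).trans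
      (Finset.card_le_card_of_injOn (fun a => (a, a)) (fun a ha => ?_) fun a _ b _ h => ?_)
    · simpa using ha
    · exact congrArg Prod.fst h
  · exact hA x hx0 hxn

theorem IsGDiffBasis.image_add_mul {g v n N : ℕ} {B : Finset ℤ} {D : Finset ℕ}
    (hB : IsGDiffBasis g v B) (hv : 0 < v) (hn : n ≤ N * v) (hlt : ∀ i ∈ D, i < N)
    (hD : ∀ x : ℤ, ∃ i ∈ D, ∃ j ∈ D, (N : ℤ) ∣ x - (i - j)) :
    IsGDiffBasis g n ((D ×ˢ B).image fun p => (p.1 : ℤ) + N * p.2) := by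
  intro x hx1 hxn
  obtain ⟨i, hi, j, hj, y, hy⟩ := hD x
  have hiN := hlt i hi
  have hjN := hlt j hj
  have hN : (0 : ℤ) < N := by omega
  have hn' : (n : ℤ) ≤ N * v := by exact_mod_cast hn
  have hy0 : 0 ≤ y := by
    by_contra! hneg
    nlinarith
  have hyv : y ≤ v := by
    by_contra! hbig
    nlinarith
  refine (hB.le_card_filter hv hy0 hyv).trans (Finset.card_le_card_of_injOn
    (fun p => ((i : ℤ) + N * p.1, (j : ℤ) + N * p.2)) (fun p hp => ?_) fun p _ p' _ h => ?_)
  · simp only [Finset.coe_filter, Finset.mem_product, Set.mem_ofPred_eq] at hp ⊢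
    refine ⟨⟨Finset.mem_image.2 ⟨(i, p.1), by simp [hi, hp.1.1], rfl⟩,
      Finset.mem_image.2 ⟨(j, p.2), by simp [hj, hp.1.2], rfl⟩⟩, ?_⟩
    linear_combination (N : ℤ) * hp.2 - hy
  · have hN0 : N ≠ 0 := by omega
    simpa [Prod.ext_iff, hN0] using h

theorem stmt7 (g v q n : ℕ) (hg : 0 < g) (hv : 0 < v) (hq : q.Prime)
    (hn : 0 < n) (hle : n ≤ (q ^ 2 + q + 1) * v) :
    eta g n ≤ (q + 1) * eta g v := by
  obtain ⟨B, hBcard, hB⟩ := exists_card_eq_eta g v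
  obtain ⟨D, hDcard, hlt, hD⟩ := exists_singer_difference_set hq
  refine (hB.image_add_mul hv hle hlt hD).eta_le_card.trans (Finset.card_image_le.trans ?_)
  rw [Finset.card_product, hBcard]
  exact Nat.mul_le_mul_right _ hDcard
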